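/- Let a, b, c, r be natural numbers with b ≥ 1, c ≥ 1 and c ≤ a + b − 1. Then F_{a,b,c}(r+1) = ((a + b − c)/(a + b))·F_{a,b−1,c}(r+1) + (c/(a + b))·F_{a,b−1,c−1}(r). In words: the cumulative distribution function of the hypergeometric distribution satisfies P(X_{a,b,c} ≤ r+1) = ((a+b−c)/(a+b))·P(X_{a,b−1,c} ≤ r+1) + (c/(a+b))·P(X_{a,b−1,c−1} ≤ r), as follows by conditioning on whether a fixed white ball is drawn. -/

import Mathlib

/-- The hypergeometric probability mass function: the probability of drawing exactly `i`
white balls when `c` balls are drawn without replacement from `a` black and `b` white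
balls, `h_{a,b,c}(i) = C(a,c−i)·C(b,i)/C(a+b,c)` (zero for `i > c`). -/
noncomputable def hypergeomPMF (a b c i : ℕ) : ℝ :=
  if i ≤ c then ((a.choose (c - i) : ℝ) * (b.choose i : ℝ)) / ((a + b).choose c : ℝ)
  else 0

/-- The hypergeometric cumulative distribution function
`F_{a,b,c}(r) = P(X_{a,b,c} ≤ r) = Σ_{i=0}^{r} h_{a,b,c}(i)`. -/
noncomputable def hypergeomCDF (a b c r : ℕ) : ℝ :=
  ∑ i ∈ Finset.range (r + 1), hypergeomPMF a b c i

/-- Conditioning the binomial denominator on a ball that is not drawn. -/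
theorem cast_div_choose_of_not_drawn {n k : ℕ} (hk : k ≤ n) (x : ℝ) :
    ((n : ℝ) + 1 - k) / ((n : ℝ) + 1) * (x / (n.choose k : ℝ)) = x / ((n + 1).choose k : ℝ) := by
  have h : (n.choose k : ℝ) * ((n : ℝ) + 1) = ((n + 1).choose k : ℝ) * ((n : ℝ) + 1 - k) := by
    have h := congrArg (Nat.cast (R := ℝ)) (Nat.choose_mul_succ_eq n k)
    rw [Nat.cast_mul, Nat.cast_mul, Nat.cast_sub (by omega)] at h
    exact_mod_cast h
  have h₁ : (n.choose k : ℝ) ≠ 0 := by exact_mod_cast (Nat.choose_pos hk).ne'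
  have h₂ : ((n + 1).choose k : ℝ) ≠ 0 := by
    exact_mod_cast (Nat.choose_pos (by omega : k ≤ n + 1)).ne'
  have h₃ : (n : ℝ) + 1 ≠ 0 := by positivity
  field_simp
  linear_combination -x * h

/-- Conditioning the binomial denominator on a ball that is drawn. -/
theorem cast_div_choose_of_drawn {n k : ℕ} (hk : k ≤ n) (x : ℝ) :
    ((k : ℝ) + 1) / ((n : ℝ) + 1) * (x / (n.choose k : ℝ)) =
      x / ((n + 1).choose (k + 1) : ℝ) := by
  have h : ((n : ℝ) + 1) * (n.choose k : ℝ) = ((n + 1).choose (k + 1) : ℝ) * ((k : ℝ) + 1) := by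
    exact_mod_cast Nat.add_one_mul_choose_eq n k
  have h₁ : (n.choose k : ℝ) ≠ 0 := by exact_mod_cast (Nat.choose_pos hk).ne'
  have h₂ : ((n + 1).choose (k + 1) : ℝ) ≠ 0 := by
    exact_mod_cast (Nat.choose_pos (by omega : k + 1 ≤ n + 1)).ne'
  have h₃ : (n : ℝ) + 1 ≠ 0 := by positivity
  field_simp
  linear_combination -x * h

theorem hypergeomPMF_succ_zero {a b c : ℕ} (hc : c ≤ a + b) :
    hypergeomPMF a (b + 1) c 0 =
      (((a + b : ℕ) : ℝ) + 1 - c) / (((a + b : ℕ) : ℝ) + 1) * hypergeomPMF a b c 0 := by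
  simp only [hypergeomPMF, Nat.zero_le, if_true, Nat.choose_zero_right]
  rw [cast_div_choose_of_not_drawn hc, add_assoc]

theorem hypergeomPMF_succ_succ {a b c : ℕ} (hc : c + 1 ≤ a + b) (i : ℕ) :
    hypergeomPMF a (b + 1) (c + 1) (i + 1) =
      (((a + b : ℕ) : ℝ) + 1 - (c + 1 : ℕ)) / (((a + b : ℕ) : ℝ) + 1) *
          hypergeomPMF a b (c + 1) (i + 1) +
        ((c : ℝ) + 1) / (((a + b : ℕ) : ℝ) + 1) * hypergeomPMF a b c i := by
  by_cases hi : i ≤ c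
  · simp only [hypergeomPMF, hi, Nat.add_le_add_iff_right, if_true, Nat.add_sub_add_right]
    rw [cast_div_choose_of_not_drawn hc, cast_div_choose_of_drawn (by omega), ← add_assoc,
      ← add_div, Nat.choose_succ_succ b i]
    push_cast
    ring
  · simp [hypergeomPMF, hi]

/-- **Hypergeometric CDF recursion by conditioning on a fixed white ball.**
For `b ≥ 1`, `c ≥ 1` and `c ≤ a + b − 1`,
`P(X_{a,b,c} ≤ r+1) = ((a+b−c)/(a+b))·P(X_{a,b−1,c} ≤ r+1) + (c/(a+b))·P(X_{a,b−1,c−1} ≤ r)`. -/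
theorem hypergeomCDF_white_ball_recursion (a b c r : ℕ) (hb : 1 ≤ b) (hc : 1 ≤ c)
    (hcab : c ≤ a + b - 1) :
    hypergeomCDF a b c (r + 1) =
      (((a : ℝ) + b - c) / ((a : ℝ) + b)) * hypergeomCDF a (b - 1) c (r + 1) +
        ((c : ℝ) / ((a : ℝ) + b)) * hypergeomCDF a (b - 1) (c - 1) r := by
  obtain ⟨b, rfl⟩ := Nat.exists_eq_add_of_le' hb
  obtain ⟨c, rfl⟩ := Nat.exists_eq_add_of_le' hc
  have h : c + 1 ≤ a + b := by omega
  simp only [Nat.add_sub_cancel, hypergeomCDF]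
  rw [Finset.sum_range_succ', Finset.sum_range_succ' (hypergeomPMF a b (c + 1)),
    hypergeomPMF_succ_zero h, Finset.sum_congr rfl fun i _ => hypergeomPMF_succ_succ h i,
    Finset.sum_add_distrib, ← Finset.mul_sum, ← Finset.mul_sum]
  push_cast
  ring
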